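/- arXiv:1107.1720 — 2 statements merged into one kernel-verified Lean document; each statement's English description precedes it below -/
import Mathlib

section
/- Let Z be a curve in ℝ^d, let 0 = t_0 < t_1 < … < t_m = 1, and write Z_i = Z[t_{i−1}, t_i] for 1 ≤ i ≤ m. Let k ≥ 1 be an integer. Suppose that for each i there is a curve S_i with the same start and end points as Z_i and a number δ_i ≥ 0 such that d_F(S_i, Z_i) ≤ δ_i and δ_i ≤ 11·d_F(W, Z_i) for every polygonal curve W with at most k+2 vertices. Let S = S_1 ⊕ S_2 ⊕ … ⊕ S_m be the concatenation. Then for every polygonal curve Q with at most k vertices, d_F(Q, Z) ≤ d_F(Q, S) + max_{1 ≤ i ≤ m} δ_i ≤ 23·d_F(Q, Z). -/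
open Set

noncomputable section

namespace Jaywalk

variable {d : ℕ}

/-- An orientation-preserving reparameterization of `[0,1]`: a continuous, strictly
increasing bijection of `[0,1]` onto itself with `f 0 = 0` and `f 1 = 1`. -/
structure IsReparam (f : ℝ → ℝ) : Prop where
  contOn : ContinuousOn f (Icc 0 1)
  strictMonoOn : StrictMonoOn f (Icc 0 1)
  mapsTo : MapsTo f (Icc 0 1) (Icc 0 1)
  surjOn : SurjOn f (Icc 0 1) (Icc 0 1)
  map_zero : f 0 = 0
  map_one : f 1 = 1

/-- The width of a reparameterization `f` with respect to curves `X Y : [0,1] → ℝ^d`. -/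
def frechetWidth (X Y : ℝ → EuclideanSpace ℝ (Fin d)) (f : ℝ → ℝ) : ℝ :=
  ⨆ t : Icc (0:ℝ) 1, ‖X (f ↑t) - Y ↑t‖

/-- The Fréchet distance between two curves `X Y : [0,1] → ℝ^d`. -/
def frechetDist (X Y : ℝ → EuclideanSpace ℝ (Fin d)) : ℝ :=
  sInf {w | ∃ f, IsReparam f ∧ w = frechetWidth X Y f}

/-- The segment from `p` to `q`, as a curve `t ↦ (1-t)·p + t·q`. -/
def seg (p q : EuclideanSpace ℝ (Fin d)) : ℝ → EuclideanSpace ℝ (Fin d) :=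
  fun t => (1 - t) • p + t • q

/-- The subcurve `Z[s,t]`, affinely reparameterized over `[0,1]`. -/
def subcurve (Z : ℝ → EuclideanSpace ℝ (Fin d)) (s t : ℝ) : ℝ → EuclideanSpace ℝ (Fin d) :=
  fun τ => Z (s + τ * (t - s))

/-- Vertices extended to all of `ℕ` (clamped at `n`). -/
def vtx {n : ℕ} (v : Fin (n+1) → EuclideanSpace ℝ (Fin d)) (i : ℕ) :
    EuclideanSpace ℝ (Fin d) :=
  v ⟨min i n, Nat.lt_succ_of_le (min_le_right i n)⟩

/-- The uniformly parameterized polygonal curve through the vertices `v 0, …, v n`. -/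
def polyCurve {n : ℕ} (v : Fin (n+1) → EuclideanSpace ℝ (Fin d)) :
    ℝ → EuclideanSpace ℝ (Fin d) :=
  fun t =>
    (1 - (t * n - ⌊t * n⌋₊)) • vtx v ⌊t * n⌋₊ + (t * n - ⌊t * n⌋₊) • vtx v (⌊t * n⌋₊ + 1)

/-- Concatenation of two curves (sharing an endpoint). -/
def concat (A B : ℝ → EuclideanSpace ℝ (Fin d)) : ℝ → EuclideanSpace ℝ (Fin d) :=
  fun t => if t ≤ 1/2 then A (2 * t) else B (2 * t - 1)

/-- Concatenation of a finite list of curves. -/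
def concatList : List (ℝ → EuclideanSpace ℝ (Fin d)) → ℝ → EuclideanSpace ℝ (Fin d)
  | [] => fun _ => 0
  | [A] => A
  | A :: B :: rest => concat A (concatList (B :: rest))

/-- Given curves `X Y`, the price of the tunnel from `a` to `b` (points of `[0,1]²`):
the Fréchet distance between the subcurve `X[a.1, b.1]` and the segment from
`Y a.2` to `Y b.2`. -/
def tunnelPrice (X Y : ℝ → EuclideanSpace ℝ (Fin d)) (a b : ℝ × ℝ) : ℝ :=
  frechetDist (subcurve X a.1 b.1) (seg (Y a.2) (Y b.2))

open Classical in
/-- Indices of marked vertices in the greedy `μ`-simplification of the polygonal curve with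
vertices `v 0, …, v n`:  start at vertex `0`; repeatedly jump to the first later vertex at
distance at least `μ` from the current one; finally also mark the last vertex `n`
(the sequence stabilizes at `n`). -/
def simplIdx (v : ℕ → EuclideanSpace ℝ (Fin d)) (μ : ℝ) (n : ℕ) : ℕ → ℕ
  | 0 => 0
  | k+1 =>
    if h : ∃ j, simplIdx v μ n k < j ∧ j ≤ n ∧ μ ≤ ‖v j - v (simplIdx v μ n k)‖
    then Nat.find h
    else n

/-- The vertices of the `μ`-simplification (with the final vertex repeated). -/
def simplVerts {n : ℕ} (v : Fin (n+1) → EuclideanSpace ℝ (Fin d)) (μ : ℝ) :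
    Fin (n+1) → EuclideanSpace ℝ (Fin d) :=
  fun k => vtx v (simplIdx (vtx v) μ n k.val)

/-- The `μ`-simplification `simpl(X, μ)` of the polygonal curve with vertices
`v 0, …, v n`: the polygonal curve through the marked vertices, in order. -/
def simpl {n : ℕ} (v : Fin (n+1) → EuclideanSpace ℝ (Fin d)) (μ : ℝ) :
    ℝ → EuclideanSpace ℝ (Fin d) :=
  polyCurve (simplVerts v μ)

/-- `y` is the parameter of a vertex of a (uniformly parameterized) polygonal curve
with `n` edges. -/
def vertexParam (n : ℕ) (y : ℝ) : Prop := ∃ i : Fin (n+1), y = ((i : ℕ) : ℝ) / n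

/-- The shortcut curve of `Y` determined by the list of shortcut parameter pairs,
starting from parameter `a`. -/
def shortcutFrom (Y : ℝ → EuclideanSpace ℝ (Fin d)) :
    List (ℝ × ℝ) → ℝ → ℝ → EuclideanSpace ℝ (Fin d)
  | [], a => subcurve Y a 1
  | (y₁, y₂) :: rest, a =>
      concat (subcurve Y a y₁) (concat (seg (Y y₁) (Y y₂)) (shortcutFrom Y rest y₂))

/-- The shortcut parameter pairs form a nondecreasing sequence inside `[0,1]` and all
parameters are vertices of the polygonal curve with `n` edges. -/
def ValidShortcuts (n : ℕ) (L : List (ℝ × ℝ)) : Prop :=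
  List.Chain' (· ≤ ·) ((0:ℝ) :: (L.flatMap fun p => [p.1, p.2]) ++ [1]) ∧
  ∀ p ∈ L, vertexParam n p.1 ∧ vertexParam n p.2

/-- The directed vertex-restricted `k`-shortcut Fréchet distance between a curve `X` and the
polygonal curve with vertices `w 0, …, w n`: the infimum of the Fréchet distance between `X`
and any vertex-restricted shortcut curve of `polyCurve w` with at most `k` shortcuts. -/
def shortcutFrechetDist {n : ℕ} (X : ℝ → EuclideanSpace ℝ (Fin d))
    (w : Fin (n+1) → EuclideanSpace ℝ (Fin d)) (k : ℕ) : ℝ :=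
  sInf {r | ∃ L : List (ℝ × ℝ), L.length ≤ k ∧ ValidShortcuts n L ∧
    r = frechetDist X (shortcutFrom (polyCurve w) L 0)}

/-- The directed vertex-restricted shortcut Fréchet distance (unbounded number of
shortcuts). -/
def shortcutFrechetDistUnbounded {n : ℕ} (X : ℝ → EuclideanSpace ℝ (Fin d))
    (w : Fin (n+1) → EuclideanSpace ℝ (Fin d)) : ℝ :=
  sInf {r | ∃ L : List (ℝ × ℝ), ValidShortcuts n L ∧
    r = frechetDist X (shortcutFrom (polyCurve w) L 0)}

namespace IsReparam

theorem of_strictMonoOn {f : ℝ → ℝ} (hc : ContinuousOn f (Icc 0 1))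
    (hm : StrictMonoOn f (Icc 0 1)) (h0 : f 0 = 0) (h1 : f 1 = 1) : IsReparam f where
  contOn := hc
  strictMonoOn := hm
  mapsTo := fun x hx => by
    have h0' := hm.monotoneOn (left_mem_Icc.2 zero_le_one) hx hx.1
    have h1' := hm.monotoneOn hx (right_mem_Icc.2 zero_le_one) hx.2
    exact ⟨h0 ▸ h0', h1 ▸ h1'⟩
  surjOn := by
    have h := intermediate_value_Icc (zero_le_one (α := ℝ)) hc
    rwa [h0, h1] at h
  map_zero := h0
  map_one := h1

theorem id : IsReparam (fun x => x) :=
  of_strictMonoOn continuousOn_id (fun _ _ _ _ h => h) rfl rfl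

theorem comp {f g : ℝ → ℝ} (hf : IsReparam f) (hg : IsReparam g) :
    IsReparam (fun x => f (g x)) :=
  of_strictMonoOn (hf.contOn.comp hg.contOn hg.mapsTo)
    (hf.strictMonoOn.comp hg.strictMonoOn hg.mapsTo)
    (by rw [hg.map_zero, hf.map_zero]) (by rw [hg.map_one, hf.map_one])

theorem exists_rightInverse {f : ℝ → ℝ} (hf : IsReparam f) :
    ∃ g, IsReparam g ∧ ∀ x ∈ Icc (0 : ℝ) 1, f (g x) = x := by
  have hmem : ∀ x ∈ Icc (0 : ℝ) 1, Function.invFunOn f (Icc 0 1) x ∈ Icc (0 : ℝ) 1 :=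
    fun x hx => Function.invFunOn_mem (hf.surjOn hx)
  have heq : ∀ x ∈ Icc (0 : ℝ) 1, f (Function.invFunOn f (Icc 0 1) x) = x :=
    fun x hx => Function.invFunOn_eq (hf.surjOn hx)
  have hinv : ∀ x ∈ Icc (0 : ℝ) 1, Function.invFunOn f (Icc 0 1) (f x) = x :=
    fun x hx => hf.strictMonoOn.injOn (hmem _ (hf.mapsTo hx)) hx (heq _ (hf.mapsTo hx))
  have hmono : StrictMonoOn (Function.invFunOn f (Icc 0 1)) (Icc 0 1) := by
    intro x hx y hy hxy
    rw [← hf.strictMonoOn.lt_iff_lt (hmem x hx) (hmem y hy), heq x hx, heq y hy]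
    exact hxy
  refine ⟨Function.invFunOn f (Icc 0 1), of_strictMonoOn ?_ hmono ?_ ?_, heq⟩
  · let e : Icc (0 : ℝ) 1 ≃o Icc (0 : ℝ) 1 :=
      { toFun := fun x => ⟨_, hmem x x.2⟩
        invFun := fun x => ⟨f x, hf.mapsTo x.2⟩
        left_inv := fun x => Subtype.ext (heq x x.2)
        right_inv := fun x => Subtype.ext (hinv x x.2)
        map_rel_iff' := fun {x y} => hmono.le_iff_le x.2 y.2 }
    exact continuousOn_iff_continuous_domRestrict.2 (continuous_subtype_val.comp e.continuous)
  · simpa [hf.map_zero] using hinv 0 (left_mem_Icc.2 zero_le_one)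
  · simpa [hf.map_one] using hinv 1 (right_mem_Icc.2 zero_le_one)

/-- The affine rescaling to `[0,1]` of a continuous strictly increasing function. -/
theorem rescale {f : ℝ → ℝ} {a b : ℝ} (hab : a < b) (hc : ContinuousOn f (Icc a b))
    (hm : StrictMonoOn f (Icc a b)) :
    IsReparam (fun x => (f (a + x * (b - a)) - f a) / (f b - f a)) := by
  have hpos : 0 < b - a := sub_pos.2 hab
  have hfpos : 0 < f b - f a :=
    sub_pos.2 (hm (left_mem_Icc.2 hab.le) (right_mem_Icc.2 hab.le) hab)
  have hmaps : MapsTo (fun x => a + x * (b - a)) (Icc 0 1) (Icc a b) := fun x hx =>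
    ⟨by nlinarith [hx.1], by nlinarith [hx.2]⟩
  refine of_strictMonoOn ?_ ?_ (by simp) (by simp [hfpos.ne'])
  · exact ((hc.comp (by fun_prop) hmaps).sub continuousOn_const).div_const _
  · intro x hx y hy hxy
    have h := hm (hmaps hx) (hmaps hy) (by simp only; nlinarith)
    simp only at h ⊢
    gcongr

/-- Two reparameterizations can be run one after the other, on `[0,c]` and on `[c,1]`. -/
theorem glue {f g : ℝ → ℝ} (hf : IsReparam f) (hg : IsReparam g) {c : ℝ} (hc0 : 0 < c)
    (hc1 : c < 1) :
    IsReparam (fun x => if x ≤ c then f (x / c) / 2 else (1 + g ((x - c) / (1 - c))) / 2) := by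
  have hc1' : 0 < 1 - c := sub_pos.2 hc1
  set F : ℝ → ℝ := fun x => if x ≤ c then f (x / c) / 2 else (1 + g ((x - c) / (1 - c))) / 2
    with hF
  have hl : EqOn F (fun x => f (x / c) / 2) (Icc 0 c) := fun x hx => if_pos hx.2
  have hr : EqOn F (fun x => (1 + g ((x - c) / (1 - c))) / 2) (Icc c 1) := by
    intro x hx
    rcases hx.1.eq_or_lt with rfl | h
    · simp [hF, hf.map_one, hg.map_zero, hc0.ne']
    · exact if_neg h.not_ge
  have hml : MapsTo (fun x => x / c) (Icc 0 c) (Icc 0 1) := fun x hx =>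
    ⟨div_nonneg hx.1 hc0.le, (div_le_one hc0).2 hx.2⟩
  have hmr : MapsTo (fun x => (x - c) / (1 - c)) (Icc c 1) (Icc 0 1) := fun x hx =>
    ⟨div_nonneg (sub_nonneg.2 hx.1) hc1'.le, (div_le_one hc1').2 (by linarith [hx.2])⟩
  have hu : Icc (0 : ℝ) 1 = Icc 0 c ∪ Icc c 1 := (Icc_union_Icc_eq_Icc hc0.le hc1.le).symm
  refine of_strictMonoOn ?_ ?_ ?_ ?_
  · rw [hu]
    refine ContinuousOn.union_of_isClosed (ContinuousOn.congr ?_ hl) (ContinuousOn.congr ?_ hr)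
      isClosed_Icc isClosed_Icc
    · exact (hf.contOn.comp (by fun_prop) hml).div_const _
    · exact (continuousOn_const.add (hg.contOn.comp (by fun_prop) hmr)).div_const _
  · rw [hu]
    refine StrictMonoOn.union (c := c) (StrictMonoOn.congr ?_ hl.symm)
      (StrictMonoOn.congr ?_ hr.symm) (isGreatest_Icc hc0.le) (isLeast_Icc hc1.le)
    · intro x hx y hy hxy
      have h := hf.strictMonoOn (hml hx) (hml hy) (by simp only; gcongr)
      simp only at h ⊢
      gcongr
    · intro x hx y hy hxy
      have h := hg.strictMonoOn (hmr hx) (hmr hy) (by simp only; gcongr)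
      simp only at h ⊢
      gcongr
  · simp [hF, hc0.le, hf.map_zero]
  · simp [hF, hc1, hg.map_one, hc1'.ne']

end IsReparam

/-- Some reparameterization matches `X` to `Y` within distance `r`. -/
def Near (X Y : ℝ → EuclideanSpace ℝ (Fin d)) (r : ℝ) : Prop :=
  ∃ f, IsReparam f ∧ ∀ t ∈ Icc (0 : ℝ) 1, ‖X (f t) - Y t‖ ≤ r

namespace Near

variable {X Y V : ℝ → EuclideanSpace ℝ (Fin d)} {r s : ℝ}

theorem symm (h : Near X Y r) : Near Y X r := by
  obtain ⟨f, hf, hfr⟩ := h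
  obtain ⟨g, hg, hfg⟩ := hf.exists_rightInverse
  refine ⟨g, hg, fun t ht => ?_⟩
  have h := hfr (g t) (hg.mapsTo ht)
  rwa [hfg t ht, norm_sub_rev] at h

theorem trans (h : Near X Y r) (h' : Near Y V s) : Near X V (r + s) := by
  obtain ⟨f, hf, hfr⟩ := h
  obtain ⟨g, hg, hgs⟩ := h'
  refine ⟨_, hf.comp hg, fun t ht => ?_⟩
  exact (norm_sub_le_norm_sub_add_norm_sub _ (Y (g t)) _).trans
    (add_le_add (hfr _ (hg.mapsTo ht)) (hgs t ht))

theorem frechetDist_le (h : Near X Y r) : frechetDist X Y ≤ r := by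
  obtain ⟨f, hf, hfr⟩ := h
  have hbdd : BddBelow {w | ∃ f, IsReparam f ∧ w = frechetWidth X Y f} := ⟨0, ?_⟩
  · exact (csInf_le hbdd ⟨f, hf, rfl⟩).trans (ciSup_le fun t => hfr t t.2)
  rintro _ ⟨g, -, rfl⟩
  exact Real.iSup_nonneg fun t => norm_nonneg _

theorem exists_norm_le (h : Near X Y r) (hY : ∃ C, ∀ t ∈ Icc (0 : ℝ) 1, ‖Y t‖ ≤ C) :
    ∃ C, ∀ t ∈ Icc (0 : ℝ) 1, ‖X t‖ ≤ C := by
  obtain ⟨f, hf, hfr⟩ := h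
  obtain ⟨C, hC⟩ := hY
  refine ⟨r + C, fun t ht => ?_⟩
  obtain ⟨s, hs, rfl⟩ := hf.surjOn ht
  linarith [norm_le_norm_sub_add (X (f s)) (Y s), hfr s hs, hC s hs]

theorem of_frechetDist_lt (hX : ∃ C, ∀ t ∈ Icc (0 : ℝ) 1, ‖X t‖ ≤ C)
    (hY : ∃ C, ∀ t ∈ Icc (0 : ℝ) 1, ‖Y t‖ ≤ C) (h : frechetDist X Y < r) : Near X Y r := by
  obtain ⟨C, hC⟩ := hX
  obtain ⟨C', hC'⟩ := hY
  obtain ⟨_, ⟨f, hf, rfl⟩, hr⟩ := exists_lt_of_csInf_lt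
    (s := {w | ∃ f, IsReparam f ∧ w = frechetWidth X Y f}) ⟨_, _, IsReparam.id, rfl⟩ h
  refine ⟨f, hf, fun t ht => le_trans ?_ hr.le⟩
  refine le_ciSup (f := fun t : Icc (0 : ℝ) 1 => ‖X (f t) - Y t‖) ⟨C + C', ?_⟩ ⟨t, ht⟩
  rintro _ ⟨u, rfl⟩
  exact (norm_sub_le _ _).trans (add_le_add (hC _ (hf.mapsTo u.2)) (hC' _ u.2))

theorem subcurve_of_reparam {f : ℝ → ℝ} (hf : IsReparam f)
    (hfr : ∀ t ∈ Icc (0 : ℝ) 1, ‖X (f t) - Y t‖ ≤ r) {a b : ℝ} (ha : 0 ≤ a) (hab : a < b)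
    (hb : b ≤ 1) : Near (subcurve X (f a) (f b)) (subcurve Y a b) r := by
  have hsub : Icc a b ⊆ Icc 0 1 := Icc_subset_Icc ha hb
  refine ⟨_, IsReparam.rescale hab (hf.contOn.mono hsub) (hf.strictMonoOn.mono hsub),
    fun x hx => ?_⟩
  have hne : f b - f a ≠ 0 := (sub_pos.2 (hf.strictMonoOn (hsub (left_mem_Icc.2 hab.le))
    (hsub (right_mem_Icc.2 hab.le)) hab)).ne'
  have h := hfr (a + x * (b - a))
    (hsub ⟨by nlinarith [hx.1], by nlinarith [hx.2]⟩)
  simpa [subcurve, div_mul_cancel₀ _ hne] using h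

theorem concat_subcurve {A B Z : ℝ → EuclideanSpace ℝ (Fin d)} {a b c : ℝ} (hab : a < b)
    (hbc : b < c) (hA : Near A (subcurve Z a b) r) (hB : Near B (subcurve Z b c) r) :
    Near (concat A B) (subcurve Z a c) r := by
  obtain ⟨f, hf, hfr⟩ := hA
  obtain ⟨g, hg, hgr⟩ := hB
  have hac : 0 < c - a := by linarith
  have hba : 0 < b - a := by linarith
  have hcb : 0 < c - b := by linarith
  set p := (b - a) / (c - a) with hp
  have hp0 : 0 < p := div_pos hba hac
  have hp1 : p < 1 := (div_lt_one hac).2 (by linarith)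
  have hpac : p * (c - a) = b - a := div_mul_cancel₀ _ hac.ne'
  refine ⟨_, hf.glue hg hp0 hp1, fun x hx => ?_⟩
  by_cases hxp : x ≤ p
  · have hmem : x / p ∈ Icc (0 : ℝ) 1 := ⟨div_nonneg hx.1 hp0.le, (div_le_one hp0).2 hxp⟩
    have h := hfr _ hmem
    have hle : f (x / p) / 2 ≤ 1 / 2 := by linarith [(hf.mapsTo hmem).2]
    have hpt : a + x / p * (b - a) = a + x * (c - a) := by
      rw [← hpac]; field_simp
    simp only [if_pos hxp, concat, if_pos hle, subcurve, hpt] at h ⊢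
    rwa [mul_div_cancel₀ _ two_ne_zero]
  · have hxp' : p < x := not_le.1 hxp
    have hp1' : 0 < 1 - p := by linarith
    have hmem : (x - p) / (1 - p) ∈ Icc (0 : ℝ) 1 :=
      ⟨div_nonneg (by linarith) hp1'.le, (div_le_one hp1').2 (by linarith [hx.2])⟩
    have hgpos : 0 < g ((x - p) / (1 - p)) := by
      rw [← hg.map_zero]
      exact hg.strictMonoOn (left_mem_Icc.2 zero_le_one) hmem (div_pos (by linarith) hp1')
    have hnle : ¬ (1 + g ((x - p) / (1 - p))) / 2 ≤ 1 / 2 := by linarith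
    have h := hgr _ hmem
    have hpt : b + (x - p) / (1 - p) * (c - b) = a + x * (c - a) := by
      have hcb' : c - b = (1 - p) * (c - a) := by linarith
      rw [hcb', ← mul_assoc, div_mul_cancel₀ _ hp1'.ne']
      linarith
    simp only [if_neg hxp, concat, if_neg hnle, subcurve, hpt] at h ⊢
    rwa [mul_div_cancel₀ _ two_ne_zero, add_sub_cancel_left]

theorem concatList_subcurve {Z : ℝ → EuclideanSpace ℝ (Fin d)} {m : ℕ} {t : Fin (m + 2) → ℝ}
    (ht : StrictMono t) {S : Fin (m + 1) → ℝ → EuclideanSpace ℝ (Fin d)}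
    (h : ∀ i, Near (S i) (subcurve Z (t i.castSucc) (t i.succ)) r) :
    Near (concatList (List.ofFn S)) (subcurve Z (t 0) (t (Fin.last _))) r := by
  induction m with
  | zero => simpa [concatList] using h 0
  | succ m ih =>
    have htail := ih (t := fun i => t i.succ) (S := fun i => S i.succ)
      (ht.comp (Fin.strictMono_succ)) (fun i => h i.succ)
    have hhead := h 0
    rw [List.ofFn_succ] at htail
    rw [List.ofFn_succ, List.ofFn_succ]
    exact concat_subcurve (ht (by simp)) (ht (by simp [Fin.lt_def])) hhead htail

end Near

section Interpolation

variable {E : Type*} [NormedAddCommGroup E] [NormedSpace ℝ E]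

/-- The piecewise affine function on `[0,∞)` taking the value `u i` at each `i : ℕ`. -/
def interp (u : ℕ → E) (s : ℝ) : E :=
  (1 - (s - ⌊s⌋₊)) • u ⌊s⌋₊ + (s - ⌊s⌋₊) • u (⌊s⌋₊ + 1)

theorem interp_of_mem_Icc (u : ℕ → E) {j : ℕ} {s : ℝ} (hs : s ∈ Icc (j : ℝ) (j + 1)) :
    interp u s = (1 - (s - j)) • u j + (s - j) • u (j + 1) := by
  rcases hs.2.lt_or_eq with h | rfl
  · have hj : ⌊s⌋₊ = j := (Nat.floor_eq_iff (j.cast_nonneg.trans hs.1)).2 ⟨hs.1, h⟩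
    rw [interp, hj]
  · have hj : ⌊(j : ℝ) + 1⌋₊ = j + 1 := by exact_mod_cast Nat.floor_natCast (R := ℝ) (j + 1)
    simp [interp, hj]

theorem interp_natCast (u : ℕ → E) (j : ℕ) : interp u j = u j := by
  simp [interp]

theorem continuousOn_interp (u : ℕ → E) (n : ℕ) : ContinuousOn (interp u) (Icc 0 n) := by
  induction n with
  | zero => simp
  | succ n ih =>
    push_cast
    rw [← Icc_union_Icc_eq_Icc n.cast_nonneg (by linarith : (n : ℝ) ≤ n + 1)]
    refine ih.union_of_isClosed (ContinuousOn.congr ?_ fun s hs => interp_of_mem_Icc u hs)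
      isClosed_Icc isClosed_Icc
    fun_prop

theorem strictMonoOn_interp {y : ℕ → ℝ} {n : ℕ} (hy : ∀ j < n, y j < y (j + 1)) :
    StrictMonoOn (interp y) (Icc 0 n) := by
  induction n with
  | zero => simp
  | succ n ih =>
    push_cast
    have hn : (n : ℝ) ≤ n + 1 := by linarith
    rw [← Icc_union_Icc_eq_Icc n.cast_nonneg hn]
    refine (ih fun j hj => hy j (by omega)).union
      (StrictMonoOn.congr ?_ fun s hs => (interp_of_mem_Icc y hs).symm)
      (isGreatest_Icc n.cast_nonneg) (isLeast_Icc hn)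
    intro s _ s' _ hss
    have h := hy n n.lt_succ_self
    simp only [smul_eq_mul]
    nlinarith

/-- Interpolation commutes with refinement of the knots. -/
theorem interp_interp (v : ℕ → E) {y : ℕ → ℝ}
    (hy : ∀ j, y j = y (j + 1) ∨
      ∃ i : ℕ, y j ∈ Icc (i : ℝ) (i + 1) ∧ y (j + 1) ∈ Icc (i : ℝ) (i + 1)) {s : ℝ}
    (hs : 0 ≤ s) : interp v (interp y s) = interp (fun j => interp v (y j)) s := by
  have hθ0 : 0 ≤ s - ⌊s⌋₊ := sub_nonneg.2 (Nat.floor_le hs)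
  have hθ1 : 0 ≤ 1 - (s - ⌊s⌋₊) := by linarith [Nat.lt_floor_add_one s]
  unfold interp at *
  change interp v _ = _ • interp v _ + _ • interp v _
  generalize ⌊s⌋₊ = j at *
  generalize s - (j : ℝ) = θ at *
  rcases hy j with h | ⟨i, h, h'⟩
  · rw [← h, ← add_smul, ← add_smul]
    simp
  · have hmem := convex_Icc (i : ℝ) (i + 1) h h' hθ1 hθ0 (by ring)
    rw [interp_of_mem_Icc v h, interp_of_mem_Icc v h', interp_of_mem_Icc v hmem]
    simp only [smul_eq_mul]
    module

end Interpolation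

theorem polyCurve_eq_interp {n : ℕ} (v : Fin (n + 1) → EuclideanSpace ℝ (Fin d)) (t : ℝ) :
    polyCurve v t = interp (vtx v) (t * n) := rfl

theorem continuousOn_polyCurve {n : ℕ} (v : Fin (n + 1) → EuclideanSpace ℝ (Fin d)) :
    ContinuousOn (polyCurve v) (Icc 0 1) := by
  refine (continuousOn_interp (vtx v) n).comp (by fun_prop : ContinuousOn (· * (n : ℝ)) _) ?_
  intro t ht
  exact ⟨mul_nonneg ht.1 n.cast_nonneg, mul_le_of_le_one_left n.cast_nonneg ht.2⟩

/-- A subcurve of a polygonal curve is, up to reparameterization, a polygonal curve with at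
most as many vertices, or a segment. -/
theorem exists_polyCurve_near_subcurve {l : ℕ} (q : Fin (l + 1) → EuclideanSpace ℝ (Fin d))
    {a b : ℝ} (ha : 0 ≤ a) (hab : a < b) (hb : b ≤ 1) :
    ∃ (n : ℕ) (w : Fin (n + 1) → EuclideanSpace ℝ (Fin d)), n ≤ l ∧
      Near (polyCurve w) (subcurve (polyCurve q) a b) 0 := by
  rcases l.eq_zero_or_pos with rfl | hl
  · exact ⟨0, q, le_rfl, _, IsReparam.id, fun t _ => by simp [polyCurve, subcurve]⟩
  have hl' : (0 : ℝ) < l := Nat.cast_pos.2 hl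
  set A := a * l with hA
  set B := b * l with hB
  have hA0 : 0 ≤ A := mul_nonneg ha hl'.le
  have hAB : A < B := mul_lt_mul_of_pos_right hab hl'
  have hBl : B ≤ l := mul_le_of_le_one_left hl'.le hb
  set i := ⌊A⌋₊
  have hiA : (i : ℝ) ≤ A := Nat.floor_le hA0
  have hAi : A < i + 1 := Nat.lt_floor_add_one A
  have hilt : i < ⌈B⌉₊ := Nat.lt_ceil.2 (hiA.trans_lt hAB)
  obtain ⟨n, hn⟩ : ∃ n, ⌈B⌉₊ = i + n := ⟨_, (Nat.add_sub_cancel' hilt.le).symm⟩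
  have hn0 : (0 : ℝ) < n := Nat.cast_pos.2 (by omega)
  have hlt : ∀ j < n, (i : ℝ) + j < B := fun j hj => by
    exact_mod_cast Nat.lt_ceil.1 (show i + j < ⌈B⌉₊ by omega)
  have hge : ∀ j, n ≤ j → B ≤ (i : ℝ) + j := fun j hj => by
    exact_mod_cast Nat.ceil_le.1 (show ⌈B⌉₊ ≤ i + j by omega)
  set y : ℕ → ℝ := fun j => max A (min B (i + j)) with hy
  have hyB : ∀ j, n ≤ j → y j = B := fun j hj => by
    simp [hy, min_eq_left (hge j hj), hAB.le]
  have hy0 : y 0 = A := by simp [hy, hiA]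
  have hstep : ∀ j < n, y j < y (j + 1) := fun j hj => by
    have h := hlt j hj
    have hj0 : (0 : ℝ) ≤ j := j.cast_nonneg
    simp only [hy, Nat.cast_add, Nat.cast_one]
    refine max_lt (lt_max_of_lt_right (lt_min hAB (by linarith))) (lt_max_of_lt_right ?_)
    exact (min_le_right _ _).trans_lt (lt_min h (by linarith))
  have hcell : ∀ j, y j = y (j + 1) ∨
      ∃ c : ℕ, y j ∈ Icc (c : ℝ) (c + 1) ∧ y (j + 1) ∈ Icc (c : ℝ) (c + 1) := fun j => by
    rcases lt_or_ge j n with hj | hj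
    · have h := hlt j hj
      have hj0 : (0 : ℝ) ≤ j := j.cast_nonneg
      refine Or.inr ⟨i + j, ⟨?_, ?_⟩, ?_, ?_⟩ <;> simp only [hy, Nat.cast_add, Nat.cast_one]
      · exact le_max_of_le_right (le_min h.le le_rfl)
      · exact max_le (by linarith) ((min_le_right _ _).trans (by linarith))
      · exact le_max_of_le_right (le_min h.le (by linarith))
      · exact max_le (by linarith) ((min_le_right _ _).trans (by linarith))
    · exact Or.inl (by rw [hyB j hj, hyB (j + 1) (by omega)])
  refine ⟨n, fun j => interp (vtx q) (y j), ?_, Near.symm ?_⟩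
  · have : ⌈B⌉₊ ≤ l := Nat.ceil_le.2 hBl
    omega
  refine ⟨_, IsReparam.rescale hn0 (continuousOn_interp y n) (strictMonoOn_interp hstep),
    fun t ht => ?_⟩
  have hvtx : vtx (fun j : Fin (n + 1) => interp (vtx q) (y j)) =
      fun j => interp (vtx q) (y j) := by
    funext j
    rcases le_total j n with hj | hj
    · simp [vtx, hj]
    · simp [vtx, hj, hyB j hj, hyB n le_rfl]
  have hend : interp y 0 = A := by simpa [hy0] using interp_natCast y 0
  have hpt : ∀ x : ℝ, (a + (x - A) / (B - A) * (b - a)) * l = x := fun x => by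
    have hBA : B - A = (b - a) * l := by rw [hA, hB]; ring
    have hba : b - a ≠ 0 := (sub_pos.2 hab).ne'
    rw [hBA]
    field_simp
    rw [hA]; ring
  rw [polyCurve_eq_interp, hvtx, subcurve, polyCurve_eq_interp, interp_natCast y n,
    hyB n le_rfl, hend, hpt, zero_add, sub_zero,
    interp_interp _ hcell (mul_nonneg ht.1 hn0.le), sub_self, norm_zero]

theorem exists_norm_le_of_continuousOn {X : ℝ → EuclideanSpace ℝ (Fin d)}
    (hX : ContinuousOn X (Icc 0 1)) : ∃ C, ∀ t ∈ Icc (0 : ℝ) 1, ‖X t‖ ≤ C :=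
  isCompact_Icc.exists_bound_of_continuousOn hX

theorem exists_norm_subcurve_le {Z : ℝ → EuclideanSpace ℝ (Fin d)}
    (hZ : ∃ C, ∀ t ∈ Icc (0 : ℝ) 1, ‖Z t‖ ≤ C) {a b : ℝ} (ha : 0 ≤ a) (hab : a ≤ b)
    (hb : b ≤ 1) : ∃ C, ∀ t ∈ Icc (0 : ℝ) 1, ‖subcurve Z a b t‖ ≤ C := by
  obtain ⟨C, hC⟩ := hZ
  exact ⟨C, fun t ht => hC _ ⟨by nlinarith [ht.1], by nlinarith [ht.2]⟩⟩

/-- Let `Z` be broken at `0 = t 0 < … < t m = 1` into pieces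
`Z_i = Z[t (i-1), t i]`. Suppose each `S i` is a curve with the same endpoints as `Z_i`,
with `d_F(S i, Z_i) ≤ δ i` and `δ i ≤ 11·d_F(W, Z_i)` for every polygonal curve `W` with at
most `k+2` vertices. Then for the concatenation `S = S 0 ⊕ … ⊕ S (m-1)` and every polygonal
curve `Q` with at most `k` vertices:
`d_F(Q, Z) ≤ d_F(Q, S) + max_i δ i ≤ 23·d_F(Q, Z)`. -/
theorem frechetDist_concat_approx {d m : ℕ} (hm : 1 ≤ m)
    (Z : ℝ → EuclideanSpace ℝ (Fin d)) (hZ : ContinuousOn Z (Icc 0 1))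
    (t : Fin (m+1) → ℝ) (hmono : StrictMono t) (h0 : t 0 = 0) (h1 : t (Fin.last m) = 1)
    (k : ℕ) (hk : 1 ≤ k)
    (S : Fin m → ℝ → EuclideanSpace ℝ (Fin d)) (δ : Fin m → ℝ)
    (hScont : ∀ i, ContinuousOn (S i) (Icc 0 1))
    (hS0 : ∀ i, S i 0 = Z (t i.castSucc)) (hS1 : ∀ i, S i 1 = Z (t i.succ))
    (hδ0 : ∀ i, 0 ≤ δ i)
    (hSd : ∀ i, frechetDist (S i) (subcurve Z (t i.castSucc) (t i.succ)) ≤ δ i)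
    (hopt : ∀ (i : Fin m) (l : ℕ) (w : Fin (l+1) → EuclideanSpace ℝ (Fin d)),
      l + 1 ≤ k + 2 →
      δ i ≤ 11 * frechetDist (polyCurve w) (subcurve Z (t i.castSucc) (t i.succ)))
    (l : ℕ) (q : Fin (l+1) → EuclideanSpace ℝ (Fin d)) (hl : l + 1 ≤ k) :
    frechetDist (polyCurve q) Z ≤
        frechetDist (polyCurve q) (concatList (List.ofFn S)) + (⨆ i, δ i) ∧
      frechetDist (polyCurve q) (concatList (List.ofFn S)) + (⨆ i, δ i) ≤
        23 * frechetDist (polyCurve q) Z := by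
  obtain ⟨m, rfl⟩ : ∃ m', m = m' + 1 := ⟨m - 1, by omega⟩
  have hmem : ∀ i, t i ∈ Icc (0 : ℝ) 1 := fun i =>
    ⟨h0 ▸ hmono.monotone (Fin.zero_le i), h1 ▸ hmono.monotone (Fin.le_last i)⟩
  have hlt : ∀ i : Fin (m + 1), t i.castSucc < t i.succ := fun i =>
    hmono i.castSucc_lt_succ
  have hZb := exists_norm_le_of_continuousOn hZ
  have hQb := exists_norm_le_of_continuousOn (continuousOn_polyCurve q)
  have hδ : ⨆ i, δ i ≤ 11 * frechetDist (polyCurve q) Z := by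
    refine ciSup_le fun i => le_of_forall_pos_le_add fun ε hε => ?_
    obtain ⟨f, hf, hfr⟩ := Near.of_frechetDist_lt hQb hZb
      (show frechetDist (polyCurve q) Z < frechetDist (polyCurve q) Z + ε / 11 by linarith)
    obtain ⟨n, w, hn, hw⟩ := exists_polyCurve_near_subcurve q (hf.mapsTo (hmem i.castSucc)).1
      (hf.strictMonoOn (hmem _) (hmem _) (hlt i)) (hf.mapsTo (hmem i.succ)).2
    have h := (hw.trans (Near.subcurve_of_reparam hf hfr (hmem i.castSucc).1 (hlt i)
      (hmem i.succ).2)).frechetDist_le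
    linarith [hopt i n w (by omega)]
  have hSZ : ∀ ε > 0, Near (concatList (List.ofFn S)) Z ((⨆ i, δ i) + ε) := fun ε hε => by
    have h := Near.concatList_subcurve (r := (⨆ i, δ i) + ε) hmono fun i =>
      Near.of_frechetDist_lt (exists_norm_le_of_continuousOn (hScont i))
        (exists_norm_subcurve_le hZb (hmem i.castSucc).1 (hlt i).le (hmem i.succ).2)
        (by linarith [hSd i, le_ciSup (Set.finite_range δ).bddAbove i])
    have hZ01 : subcurve Z 0 1 = Z := by funext x; simp [subcurve]
    rwa [h0, h1, hZ01] at h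
  have hSb := (hSZ 1 one_pos).exists_norm_le hZb
  constructor
  · refine le_of_forall_pos_le_add fun ε hε => ?_
    have h := ((Near.of_frechetDist_lt hQb hSb (lt_add_of_pos_right _ (half_pos hε))).trans
      (hSZ _ (half_pos hε))).frechetDist_le
    linarith
  · have hle : frechetDist (polyCurve q) (concatList (List.ofFn S)) ≤
        frechetDist (polyCurve q) Z + ⨆ i, δ i := by
      refine le_of_forall_pos_le_add fun ε hε => ?_
      have h := ((Near.of_frechetDist_lt hQb hZb (lt_add_of_pos_right _ (half_pos hε))).trans
        (hSZ _ (half_pos hε)).symm).frechetDist_le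
      linarith
    linarith

end Jaywalk
end
end

section
/- There exist polygonal curves X, Y, Z in ℝ² such that the directed vertex-restricted shortcut Fréchet distance fails the triangle inequality: d_S(X, Z) > d_S(X, Y) + d_S(Y, Z); moreover, the same curves satisfy d_S^k(X, Z) > d_S^k(X, Y) + d_S^k(Y, Z) for every integer k ≥ 1. -/
open Set

noncomputable section

namespace Jaywalk

variable {d : ℕ}

theorem isReparam_id : IsReparam (fun t => t) where
  contOn := continuousOn_id
  strictMonoOn := strictMono_id.strictMonoOn _
  mapsTo := mapsTo_id _
  surjOn := surjOn_id _
  map_zero := rfl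
  map_one := rfl

theorem frechetWidth_nonneg (X Y : ℝ → EuclideanSpace ℝ (Fin d)) (f : ℝ → ℝ) :
    0 ≤ frechetWidth X Y f :=
  Real.iSup_nonneg fun _ => norm_nonneg _

theorem frechetDist_nonneg (X Y : ℝ → EuclideanSpace ℝ (Fin d)) : 0 ≤ frechetDist X Y := by
  refine Real.sInf_nonneg ?_
  rintro _ ⟨f, -, rfl⟩
  exact frechetWidth_nonneg X Y f

theorem frechetDist_eq_zero_of_eqOn {X Y : ℝ → EuclideanSpace ℝ (Fin d)}
    (h : EqOn X Y (Icc 0 1)) : frechetDist X Y = 0 := by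
  refine le_antisymm (csInf_le ⟨0, ?_⟩ ⟨_, isReparam_id, ?_⟩) (frechetDist_nonneg X Y)
  · rintro _ ⟨f, -, rfl⟩
    exact frechetWidth_nonneg X Y f
  · have h0 : ∀ t : Icc (0:ℝ) 1, ‖X ↑t - Y ↑t‖ = 0 := fun t => by simp [h t.2]
    simp [frechetWidth, h0]

/-- A lower bound on the Fréchet distance of bounded curves, from a witness parameter for every
reparameterization. -/
theorem le_frechetDist {X Y : ℝ → EuclideanSpace ℝ (Fin d)} {r CX CY : ℝ}
    (hX : ∀ t ∈ Icc (0:ℝ) 1, ‖X t‖ ≤ CX) (hY : ∀ t ∈ Icc (0:ℝ) 1, ‖Y t‖ ≤ CY)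
    (h : ∀ f, IsReparam f → ∃ t ∈ Icc (0:ℝ) 1, r ≤ ‖X (f t) - Y t‖) :
    r ≤ frechetDist X Y := by
  refine le_csInf ⟨_, _, isReparam_id, rfl⟩ ?_
  rintro _ ⟨f, hf, rfl⟩
  obtain ⟨t, ht, hr⟩ := h f hf
  refine hr.trans (le_ciSup (f := fun t : Icc (0:ℝ) 1 => ‖X (f ↑t) - Y ↑t‖) ⟨CX + CY, ?_⟩ ⟨t, ht⟩)
  rintro _ ⟨s, rfl⟩
  exact (norm_sub_le _ _).trans (add_le_add (hX _ (hf.mapsTo s.2)) (hY _ s.2))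

theorem polyCurve_eq_of_mem_edge {n : ℕ} (v : Fin (n+1) → EuclideanSpace ℝ (Fin d)) {t : ℝ}
    (k : ℕ) (h₁ : (k:ℝ) ≤ t * n) (h₂ : t * n ≤ k + 1) :
    polyCurve v t = (1 - (t * n - k)) • vtx v k + (t * n - k) • vtx v (k + 1) := by
  rcases h₂.eq_or_lt with h | h
  · have hf : ⌊t * n⌋₊ = k + 1 := by rw [h]; exact_mod_cast Nat.floor_natCast (k + 1)
    rw [polyCurve, hf, h]
    simp
  · have hf : ⌊t * n⌋₊ = k := (Nat.floor_eq_iff (k.cast_nonneg.trans h₁)).2 ⟨h₁, h⟩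
    simp [polyCurve, hf]

theorem shortcutFrom_zero (Y : ℝ → EuclideanSpace ℝ (Fin d)) (L : List (ℝ × ℝ)) (a : ℝ) :
    shortcutFrom Y L a 0 = Y a := by
  cases L <;> simp [shortcutFrom, concat, subcurve]

/-- The unit vector along the first axis. -/
def axis : EuclideanSpace ℝ (Fin 2) := EuclideanSpace.single 0 1

theorem norm_smul_axis (s : ℝ) : ‖s • axis‖ = |s| := by
  simp [axis, norm_smul]

/-- The vertices at heights `0, 1, 0` on the axis. -/
def tentVerts : Fin 3 → EuclideanSpace ℝ (Fin 2) :=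
  fun i => (![0, 1, 0] i : ℝ) • axis

/-- The vertices of the tent together with the midpoints of its edges. -/
def subdividedTentVerts : Fin 5 → EuclideanSpace ℝ (Fin 2) :=
  fun i => (![0, 1/2, 1, 1/2, 0] i : ℝ) • axis

/-- The vertices of the tent truncated at height `1/2`. -/
def truncatedTentVerts : Fin 5 → EuclideanSpace ℝ (Fin 2) :=
  fun i => (![0, 1/4, 1/2, 1/2, 0] i : ℝ) • axis

theorem polyCurve_tent {t : ℝ} (ht : t ∈ Icc (0:ℝ) 1) :
    polyCurve tentVerts t = min (2 * t) (2 - 2 * t) • axis := by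
  obtain ⟨h0, h1⟩ := ht
  rcases le_total t (1/2) with h | h
  · rw [polyCurve_eq_of_mem_edge _ 0 (by push_cast; linarith) (by push_cast; linarith),
      min_eq_left (by linarith)]
    simp only [vtx, tentVerts]
    norm_num
    module
  · rw [polyCurve_eq_of_mem_edge _ 1 (by push_cast; linarith) (by push_cast; linarith),
      min_eq_right (by linarith)]
    simp only [vtx, tentVerts]
    norm_num
    module

theorem polyCurve_subdividedTent {t : ℝ} (ht : t ∈ Icc (0:ℝ) 1) :
    polyCurve subdividedTentVerts t = min (2 * t) (2 - 2 * t) • axis := by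
  obtain ⟨h0, h1⟩ := ht
  rcases le_total t (1/2) with h | h
  · rw [min_eq_left (by linarith)]
    rcases le_total t (1/4) with h' | h'
    · rw [polyCurve_eq_of_mem_edge _ 0 (by push_cast; linarith) (by push_cast; linarith)]
      simp only [vtx, subdividedTentVerts]
      norm_num
      module
    · rw [polyCurve_eq_of_mem_edge _ 1 (by push_cast; linarith) (by push_cast; linarith)]
      simp only [vtx, subdividedTentVerts]
      norm_num
      module
  · rw [min_eq_right (by linarith)]
    rcases le_total t (3/4) with h' | h'
    · rw [polyCurve_eq_of_mem_edge _ 2 (by push_cast; linarith) (by push_cast; linarith)]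
      simp only [vtx, subdividedTentVerts]
      norm_num
      module
    · rw [polyCurve_eq_of_mem_edge _ 3 (by push_cast; linarith) (by push_cast; linarith)]
      simp only [vtx, subdividedTentVerts]
      norm_num
      module

theorem polyCurve_truncatedTent {t : ℝ} (ht : t ∈ Icc (0:ℝ) 1) :
    polyCurve truncatedTentVerts t = min t (min (1/2) (2 - 2 * t)) • axis := by
  obtain ⟨h0, h1⟩ := ht
  rcases le_total t (1/2) with h | h
  · rw [min_eq_left (le_min h (by linarith))]
    rcases le_total t (1/4) with h' | h'
    · rw [polyCurve_eq_of_mem_edge _ 0 (by push_cast; linarith) (by push_cast; linarith)]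
      simp only [vtx, truncatedTentVerts]
      norm_num
      module
    · rw [polyCurve_eq_of_mem_edge _ 1 (by push_cast; linarith) (by push_cast; linarith)]
      simp only [vtx, truncatedTentVerts]
      norm_num
      module
  · rw [min_eq_right ((min_le_left _ _).trans h)]
    rcases le_total t (3/4) with h' | h'
    · rw [polyCurve_eq_of_mem_edge _ 2 (by push_cast; linarith) (by push_cast; linarith),
        min_eq_left (by linarith)]
      simp only [vtx, truncatedTentVerts]
      norm_num
      module
    · rw [polyCurve_eq_of_mem_edge _ 3 (by push_cast; linarith) (by push_cast; linarith),
        min_eq_right (by linarith)]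
      simp only [vtx, truncatedTentVerts]
      norm_num
      module

/-- The shortcut between the two edge midpoints turns the subdivided tent into the truncated
tent. -/
theorem shortcutFrom_subdividedTent_eqOn :
    EqOn (polyCurve truncatedTentVerts)
      (shortcutFrom (polyCurve subdividedTentVerts) [(1/4, 3/4)] 0) (Icc 0 1) := by
  intro t ht
  rw [polyCurve_truncatedTent ht]
  obtain ⟨h0, h1⟩ := ht
  simp only [shortcutFrom, concat, subcurve, seg]
  split_ifs with h h'
  · rw [polyCurve_subdividedTent ⟨by linarith, by linarith⟩, min_eq_left (le_min h (by linarith)),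
      min_eq_left (by linarith)]
    congr 1
    ring
  · rw [polyCurve_subdividedTent ⟨by norm_num, by norm_num⟩,
      polyCurve_subdividedTent ⟨by norm_num, by norm_num⟩,
      min_eq_left (a := (1/2 : ℝ)) (by linarith), min_eq_right (by linarith)]
    norm_num
    module
  · rw [polyCurve_subdividedTent ⟨by linarith, by linarith⟩,
      min_eq_right (a := (1/2 : ℝ)) (by linarith), min_eq_right (a := t) (by linarith),
      min_eq_right (by linarith)]
    congr 1
    ring

/-- A curve inside the segment from `0` to `axis` which reaches `axis` or is constantly `0`. -/
structure ReachesOrTrivial (C : ℝ → EuclideanSpace ℝ (Fin 2)) : Prop where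
  mem_segment : ∀ t ∈ Icc (0:ℝ) 1, ∃ s ∈ Icc (0:ℝ) 1, C t = s • axis
  reaches_or_trivial : (∃ t ∈ Icc (0:ℝ) 1, C t = axis) ∨ ∀ t ∈ Icc (0:ℝ) 1, C t = 0

theorem ReachesOrTrivial.concat {A B : ℝ → EuclideanSpace ℝ (Fin 2)}
    (hA : ReachesOrTrivial A) (hB : ReachesOrTrivial B) (hAB : A 1 = B 0) :
    ReachesOrTrivial (concat A B) := by
  have key : ∀ t ∈ Icc (0:ℝ) 1, (∃ s ∈ Icc (0:ℝ) 1, Jaywalk.concat A B t = A s) ∨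
      ∃ s ∈ Icc (0:ℝ) 1, Jaywalk.concat A B t = B s := by
    rintro t ⟨h0, h1⟩
    by_cases h : t ≤ 1/2
    · exact .inl ⟨2 * t, ⟨by linarith, by linarith⟩, if_pos h⟩
    · exact .inr ⟨2 * t - 1, ⟨by linarith, by linarith⟩, if_neg h⟩
  refine ⟨fun t ht => ?_, ?_⟩
  · rcases key t ht with ⟨s, hs, h⟩ | ⟨s, hs, h⟩ <;> rw [h]
    exacts [hA.mem_segment s hs, hB.mem_segment s hs]
  · rcases hA.reaches_or_trivial with ⟨t, ⟨h0, h1⟩, ht⟩ | hA0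
    · refine .inl ⟨t / 2, ⟨by linarith, by linarith⟩, ?_⟩
      rw [Jaywalk.concat, if_pos (by linarith), mul_div_cancel₀ t two_ne_zero, ht]
    rcases hB.reaches_or_trivial with ⟨t, ⟨h0, h1⟩, ht⟩ | hB0
    · refine .inl ⟨(t + 1) / 2, ⟨by linarith, by linarith⟩, ?_⟩
      rw [Jaywalk.concat]
      split_ifs with h
      · obtain rfl : t = 0 := by linarith
        rw [← ht, ← hAB]
        norm_num
      · rw [← ht]
        congr 1
        ring
    · refine .inr fun t ht => ?_
      rcases key t ht with ⟨s, hs, h⟩ | ⟨s, hs, h⟩ <;> rw [h]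
      exacts [hA0 s hs, hB0 s hs]

theorem vertexParam_two {a : ℝ} (ha : vertexParam 2 a) : a = 0 ∨ a = 1/2 ∨ a = 1 := by
  obtain ⟨i, rfl⟩ := ha
  fin_cases i <;> norm_num

theorem vertexParam.tent_eq {a : ℝ} (ha : vertexParam 2 a) :
    polyCurve tentVerts a = 0 ∨ polyCurve tentVerts a = axis := by
  rcases vertexParam_two ha with rfl | rfl | rfl <;>
    rw [polyCurve_tent ⟨by norm_num, by norm_num⟩] <;> norm_num

theorem reachesOrTrivial_seg {p q : EuclideanSpace ℝ (Fin 2)} (hp : p = 0 ∨ p = axis)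
    (hq : q = 0 ∨ q = axis) : ReachesOrTrivial (seg p q) := by
  refine ⟨?_, ?_⟩
  · rintro t ⟨h0, h1⟩
    rcases hp with rfl | rfl <;> rcases hq with rfl | rfl
    · exact ⟨0, ⟨le_rfl, zero_le_one⟩, by simp [seg]⟩
    · exact ⟨t, ⟨h0, h1⟩, by simp [seg]⟩
    · exact ⟨1 - t, ⟨by linarith, by linarith⟩, by simp [seg]⟩
    · exact ⟨1, ⟨zero_le_one, le_rfl⟩, by simp only [seg]; module⟩
  · rcases hp with rfl | rfl
    · rcases hq with rfl | rfl
      · exact .inr fun t _ => by simp [seg]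
      · exact .inl ⟨1, ⟨zero_le_one, le_rfl⟩, by simp [seg]⟩
    · exact .inl ⟨0, ⟨le_rfl, zero_le_one⟩, by simp [seg]⟩

theorem reachesOrTrivial_subcurve_tent {a b : ℝ} (ha : vertexParam 2 a) (hb : vertexParam 2 b) :
    ReachesOrTrivial (subcurve (polyCurve tentVerts) a b) := by
  have hmid : polyCurve tentVerts (1/2) = axis := by
    rw [polyCurve_tent ⟨by norm_num, by norm_num⟩]
    norm_num
  replace ha := vertexParam_two ha
  replace hb := vertexParam_two hb
  refine ⟨?_, ?_⟩
  · have unit : ∀ {c : ℝ}, c = 0 ∨ c = 1/2 ∨ c = 1 → 0 ≤ c ∧ c ≤ 1 := by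
      rintro c (rfl | rfl | rfl) <;> norm_num
    obtain ⟨a0, a1⟩ := unit ha
    obtain ⟨b0, b1⟩ := unit hb
    rintro t ⟨h0, h1⟩
    have hmem : a + t * (b - a) ∈ Icc (0:ℝ) 1 :=
      ⟨by nlinarith, by nlinarith⟩
    refine ⟨_, ⟨le_min ?_ ?_, ?_⟩, polyCurve_tent hmem⟩
    · linarith [hmem.1]
    · linarith [hmem.2]
    · rcases le_total (a + t * (b - a)) (1/2) with h | h
      · exact (min_le_left _ _).trans (by linarith)
      · exact (min_le_right _ _).trans (by linarith)
  · have reach : ∀ t ∈ Icc (0:ℝ) 1, a + t * (b - a) = 1/2 →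
        (∃ t ∈ Icc (0:ℝ) 1, subcurve (polyCurve tentVerts) a b t = axis) ∨
          ∀ t ∈ Icc (0:ℝ) 1, subcurve (polyCurve tentVerts) a b t = 0 :=
      fun t ht h => .inl ⟨t, ht, by rw [subcurve, h, hmid]⟩
    rcases ha with rfl | rfl | rfl <;> rcases hb with rfl | rfl | rfl
    · exact .inr fun t _ => by simp [subcurve, polyCurve_tent]
    · exact reach 1 (by norm_num) (by norm_num)
    · exact reach (1/2) (by norm_num) (by norm_num)
    · exact reach 0 (by norm_num) (by norm_num)
    · exact reach 0 (by norm_num) (by norm_num)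
    · exact reach 0 (by norm_num) (by norm_num)
    · exact reach (1/2) (by norm_num) (by norm_num)
    · exact reach 1 (by norm_num) (by norm_num)
    · exact .inr fun t _ => by simp [subcurve, polyCurve_tent]

theorem reachesOrTrivial_shortcutFrom_tent (L : List (ℝ × ℝ))
    (hL : ∀ p ∈ L, vertexParam 2 p.1 ∧ vertexParam 2 p.2) {a : ℝ} (ha : vertexParam 2 a) :
    ReachesOrTrivial (shortcutFrom (polyCurve tentVerts) L a) := by
  induction L generalizing a with
  | nil => exact reachesOrTrivial_subcurve_tent ha ⟨2, by norm_num⟩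
  | cons p L ih =>
    obtain ⟨h₁, h₂⟩ := hL p List.mem_cons_self
    refine (reachesOrTrivial_subcurve_tent ha h₁).concat
      ((reachesOrTrivial_seg h₁.tent_eq h₂.tent_eq).concat
        (ih (fun q hq => hL q (List.mem_cons_of_mem _ hq)) h₂) ?_) ?_
    · simp [seg, shortcutFrom_zero]
    · simp [subcurve, concat, seg]

theorem half_le_frechetDist_truncatedTent {C : ℝ → EuclideanSpace ℝ (Fin 2)}
    (hC : ReachesOrTrivial C) : 1/2 ≤ frechetDist (polyCurve truncatedTentVerts) C := by
  have hX : ∀ t ∈ Icc (0:ℝ) 1, ∃ s ∈ Icc (0:ℝ) (1/2),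
      polyCurve truncatedTentVerts t = s • axis := fun t ht =>
    ⟨_, ⟨le_min ht.1 (le_min (by norm_num) (by linarith [ht.2])),
      (min_le_right _ _).trans (min_le_left _ _)⟩, polyCurve_truncatedTent ht⟩
  refine le_frechetDist (CX := 1/2) (CY := 1) (fun t ht => ?_) (fun t ht => ?_) fun f hf => ?_
  · obtain ⟨s, hs, h⟩ := hX t ht
    rw [h, norm_smul_axis, abs_of_nonneg hs.1]
    exact hs.2
  · obtain ⟨s, hs, h⟩ := hC.mem_segment t ht
    rw [h, norm_smul_axis, abs_of_nonneg hs.1]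
    exact hs.2
  · rcases hC.reaches_or_trivial with ⟨t, ht, h⟩ | h0
    · obtain ⟨s, hs, h'⟩ := hX (f t) (hf.mapsTo ht)
      refine ⟨t, ht, ?_⟩
      rw [h, h', show s • axis - axis = (s - 1) • axis by module, norm_smul_axis]
      exact le_abs.2 (.inr (by linarith [hs.2]))
    · obtain ⟨t, ht, hft⟩ := hf.surjOn (show (1/2 : ℝ) ∈ Icc (0:ℝ) 1 by norm_num)
      refine ⟨t, ht, ?_⟩
      rw [h0 t ht, hft, polyCurve_truncatedTent ⟨by norm_num, by norm_num⟩, sub_zero,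
        norm_smul_axis]
      norm_num

theorem validShortcuts_nil (n : ℕ) : ValidShortcuts n [] :=
  ⟨.cons_cons zero_le_one (.singleton _), by simp⟩

theorem validShortcuts_subdividedTent : ValidShortcuts 4 [(1/4, 3/4)] := by
  refine ⟨.cons_cons (by norm_num) (.cons_cons (by norm_num) (.cons_cons (by norm_num)
    (.singleton _))), ?_⟩
  simp only [List.mem_singleton, forall_eq]
  exact ⟨⟨1, by norm_num⟩, ⟨3, by norm_num⟩⟩

/-- The infimum defining the shortcut distances, over any family of shortcut lists, is at most
`0` as soon as some list in the family reproduces the curve `X`. -/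
theorem sInf_frechetDist_le_zero {X : ℝ → EuclideanSpace ℝ (Fin d)}
    {S : List (ℝ × ℝ) → ℝ → EuclideanSpace ℝ (Fin d)} {P : List (ℝ × ℝ) → Prop}
    {L : List (ℝ × ℝ)} (hL : P L) (h : EqOn X (S L) (Icc 0 1)) :
    sInf {r | ∃ L, P L ∧ r = frechetDist X (S L)} ≤ 0 := by
  refine csInf_le ⟨0, ?_⟩ ⟨L, hL, (frechetDist_eq_zero_of_eqOn h).symm⟩
  rintro _ ⟨M, -, rfl⟩
  exact frechetDist_nonneg _ _

/-- The directed vertex-restricted shortcut Fréchet distance fails the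
triangle inequality: there are polygonal curves `X, Y, Z` in `ℝ²` with
`d_S(X, Z) > d_S(X, Y) + d_S(Y, Z)`, and moreover
`d_S^k(X, Z) > d_S^k(X, Y) + d_S^k(Y, Z)` for every `k ≥ 1`. -/
theorem shortcutFrechetDist_not_triangle :
    ∃ (nX nY nZ : ℕ) (x : Fin (nX+1) → EuclideanSpace ℝ (Fin 2))
      (y : Fin (nY+1) → EuclideanSpace ℝ (Fin 2))
      (z : Fin (nZ+1) → EuclideanSpace ℝ (Fin 2)),
      shortcutFrechetDistUnbounded (polyCurve x) y +
          shortcutFrechetDistUnbounded (polyCurve y) z <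
        shortcutFrechetDistUnbounded (polyCurve x) z ∧
      ∀ k : ℕ, 1 ≤ k →
        shortcutFrechetDist (polyCurve x) y k + shortcutFrechetDist (polyCurve y) z k <
          shortcutFrechetDist (polyCurve x) z k := by
  have hXY := shortcutFrom_subdividedTent_eqOn
  have hYZ : EqOn (polyCurve subdividedTentVerts)
      (shortcutFrom (polyCurve tentVerts) [] 0) (Icc 0 1) := fun t ht => by
    simp [shortcutFrom, subcurve, polyCurve_subdividedTent ht, polyCurve_tent ht]
  have hXZ : ∀ L, ValidShortcuts 2 L → 1/2 ≤ frechetDist (polyCurve truncatedTentVerts)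
      (shortcutFrom (polyCurve tentVerts) L 0) := fun L hL =>
    half_le_frechetDist_truncatedTent
      (reachesOrTrivial_shortcutFrom_tent L hL.2 ⟨0, by norm_num⟩)
  refine ⟨4, 4, 2, truncatedTentVerts, subdividedTentVerts, tentVerts, ?_, fun k hk => ?_⟩
  · have h₁ : shortcutFrechetDistUnbounded (polyCurve truncatedTentVerts)
        subdividedTentVerts ≤ 0 :=
      sInf_frechetDist_le_zero validShortcuts_subdividedTent hXY
    have h₂ : shortcutFrechetDistUnbounded (polyCurve subdividedTentVerts) tentVerts ≤ 0 :=
      sInf_frechetDist_le_zero (validShortcuts_nil 2) hYZ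
    have h₃ : 1/2 ≤ shortcutFrechetDistUnbounded (polyCurve truncatedTentVerts) tentVerts := by
      refine le_csInf ⟨_, [], validShortcuts_nil 2, rfl⟩ ?_
      rintro _ ⟨L, hL, rfl⟩
      exact hXZ L hL
    linarith
  · have h₁ : shortcutFrechetDist (polyCurve truncatedTentVerts) subdividedTentVerts k ≤ 0 := by
      simp only [shortcutFrechetDist, ← and_assoc]
      exact sInf_frechetDist_le_zero (L := [(1/4, 3/4)]) ⟨hk, validShortcuts_subdividedTent⟩ hXY
    have h₂ : shortcutFrechetDist (polyCurve subdividedTentVerts) tentVerts k ≤ 0 := by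
      simp only [shortcutFrechetDist, ← and_assoc]
      exact sInf_frechetDist_le_zero (L := []) ⟨k.zero_le, validShortcuts_nil 2⟩ hYZ
    have h₃ : 1/2 ≤ shortcutFrechetDist (polyCurve truncatedTentVerts) tentVerts k := by
      refine le_csInf ⟨_, [], k.zero_le, validShortcuts_nil 2, rfl⟩ ?_
      rintro _ ⟨L, -, hL, rfl⟩
      exact hXZ L hL
    linarith

end Jaywalk
end
end
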